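/- arXiv:1705.06811 — 2 statements merged into one kernel-verified Lean document; each statement's English description precedes it below -/
import Mathlib

section
/- Every real Banach space X containing an isomorphic copy of c₀ (i.e., having a closed linear subspace linearly homeomorphic to the space c₀ of real null sequences with the supremum norm) admits an infinite equilateral set: there exist λ > 0 and an infinite subset S ⊆ X such that ‖x - y‖ = λ for all distinct x, y ∈ S. -/
open scoped ZeroAtInfty

namespace EqC0

variable {X : Type*} [NormedAddCommGroup X] [NormedSpace ℝ X]

lemma scale (U : (ℕ →₀ ℝ) →ₗ[ℝ] X) (M : ℝ)
    (hU : ∀ f : ℕ →₀ ℝ, (∀ k, |f k| ≤ 1) → ‖U f‖ ≤ M) (c : ℝ) (hc : 0 ≤ c)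
    (f : ℕ →₀ ℝ) (hf : ∀ k, |f k| ≤ c) : ‖U f‖ ≤ c * M := by
  rcases hc.eq_or_lt with rfl | hc
  · have : f = 0 := by
      ext k
      have := hf k
      simpa using this
    simp [this]
  · have h := hU (c⁻¹ • f) (by
      intro k
      rw [Finsupp.smul_apply, smul_eq_mul, abs_mul, abs_of_pos (inv_pos.2 hc)]
      rw [inv_mul_le_iff₀ hc]
      simpa using hf k)
    rw [map_smul, norm_smul, Real.norm_of_nonneg (inv_nonneg.2 hc.le), inv_mul_le_iff₀ hc] at h
    exact h

/-- James' distortion argument. -/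
lemma james (T : (ℕ →₀ ℝ) →ₗ[ℝ] X) (M m : ℝ) (hm : 0 < m)
    (hT : ∀ f : ℕ →₀ ℝ, (∀ k, |f k| ≤ 1) → ‖T f‖ ≤ M)
    (hT' : ∀ k, m ≤ ‖T (Finsupp.single k 1)‖) :
    ∃ U : (ℕ →₀ ℝ) →ₗ[ℝ] X, (∀ f : ℕ →₀ ℝ, (∀ k, |f k| ≤ 1) → ‖U f‖ ≤ 1) ∧
      ∀ k, 99 / 100 ≤ ‖U (Finsupp.single k 1)‖ := by
  let A : ℕ → Set (ℕ →₀ ℝ) := fun n => {f | (∀ k, |f k| ≤ 1) ∧ ∀ k < n, f k = 0}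
  let B : ℕ → Set ℝ := fun n => (fun f => ‖T f‖) '' A n
  have hbdd : ∀ n, BddAbove (B n) := by
    intro n
    refine ⟨M, ?_⟩
    rintro _ ⟨f, hf, rfl⟩
    exact hT f hf.1
  have hsA : ∀ n, Finsupp.single n (1:ℝ) ∈ A n := by
    intro n
    refine ⟨fun k => ?_, fun k hk => ?_⟩
    · rw [Finsupp.single_apply]; split_ifs <;> simp
    · rw [Finsupp.single_apply, if_neg (by omega)]
  have hne : ∀ n, (B n).Nonempty := fun n => ⟨_, _, hsA n, rfl⟩
  let K : ℕ → ℝ := fun n => sSup (B n)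
  have hKm : ∀ n, m ≤ K n := fun n => (hT' n).trans (le_csSup (hbdd n) ⟨_, hsA n, rfl⟩)
  have hKle : ∀ n f, f ∈ A n → ‖T f‖ ≤ K n := fun n f hf => le_csSup (hbdd n) ⟨_, hf, rfl⟩
  have hKb : BddBelow (Set.range K) := ⟨m, by rintro _ ⟨n, rfl⟩; exact hKm n⟩
  let L : ℝ := ⨅ n, K n
  have hL : 0 < L := hm.trans_le (le_ciInf hKm)
  have hLK : ∀ n, L ≤ K n := fun n => ciInf_le hKb n
  obtain ⟨n0, hn0⟩ : ∃ n0, K n0 < L * (1001 / 1000) :=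
    exists_lt_of_ciInf_lt (show (⨅ n, K n) < L * (1001 / 1000) by
      change L < _; linarith)
  have hch : ∀ n, ∃ f ∈ A n, L * (999 / 1000) < ‖T f‖ := by
    intro n
    obtain ⟨_, ⟨f, hf, rfl⟩, h⟩ := exists_lt_of_lt_csSup (hne n)
      (show L * (999 / 1000) < sSup (B n) by have := hLK n; change _ < K n; linarith)
    exact ⟨f, hf, h⟩
  choose F hFA hFn using hch
  have hb : ∀ n, ∃ b, n ≤ b ∧ ∀ k, b ≤ k → F n k = 0 := by
    intro n
    refine ⟨max n ((F n).support.sup id + 1), le_max_left _ _, fun k hk => ?_⟩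
    by_contra h
    have := Finset.le_sup (f := id) (Finsupp.mem_support_iff.2 h)
    have h2 := le_trans (le_max_right _ _) hk
    simp only [id] at this h2
    omega
  choose b hb1 hb2 using hb
  let N : ℕ → ℕ := fun j => b^[j] n0
  have hNs : ∀ j, N (j + 1) = b (N j) := fun j => Function.iterate_succ_apply' _ _ _
  have hN : Monotone N := monotone_nat_of_le_succ fun j => by rw [hNs]; exact hb1 _
  have hN0 : N 0 = n0 := rfl
  let v : ℕ → (ℕ →₀ ℝ) := fun j => F (N j)
  have hdisj : ∀ k j j', v j k ≠ 0 → j ≠ j' → v j' k = 0 := by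
    intro k j j' h hjj
    have h1 : N j ≤ k := by
      by_contra hh
      exact h ((hFA (N j)).2 k (by omega))
    have h2 : k < N (j + 1) := by
      by_contra hh
      rw [hNs] at hh
      exact h (hb2 (N j) k (by omega))
    rcases lt_or_gt_of_ne hjj with hlt | hgt
    · exact (hFA (N j')).2 k (h2.trans_le (hN hlt))
    · apply hb2 (N j') k
      rw [← hNs]
      exact (hN hgt).trans h1
  have hK0 : 0 < K n0 := hL.trans_le (hLK n0)
  refine ⟨(K n0)⁻¹ • (T ∘ₗ Finsupp.linearCombination ℝ v), fun f hf => ?_, fun k => ?_⟩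
  · simp only [LinearMap.smul_apply, LinearMap.comp_apply]
    rw [norm_smul, Real.norm_of_nonneg (inv_nonneg.2 hK0.le), inv_mul_le_iff₀ hK0, mul_one]
    apply hKle
    have key : ∀ k, Finsupp.linearCombination ℝ v f k = ∑ j ∈ f.support, f j * v j k := by
      intro k
      rw [Finsupp.linearCombination_apply, Finsupp.sum, Finsupp.finsetSum_apply]
      simp
    refine ⟨fun k => ?_, fun k hk => ?_⟩
    · rw [key]
      by_cases h : ∃ j ∈ f.support, v j k ≠ 0
      · obtain ⟨j, hj, hjk⟩ := h
        rw [Finset.sum_eq_single_of_mem j hj (fun j' _ hne => by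
          rw [hdisj k j j' hjk hne.symm, mul_zero]), abs_mul]
        exact mul_le_one₀ (hf j) (abs_nonneg _) ((hFA (N j)).1 k)
      · push Not at h
        rw [Finset.sum_eq_zero (fun j hj => by rw [h j hj, mul_zero])]
        simp
    · rw [key]
      apply Finset.sum_eq_zero
      intro j _
      rw [show v j k = 0 from (hFA (N j)).2 k (hk.trans_le (hN (Nat.zero_le j))), mul_zero]
  · simp only [LinearMap.smul_apply, LinearMap.comp_apply, Finsupp.linearCombination_single,
      one_smul]
    rw [norm_smul, Real.norm_of_nonneg (inv_nonneg.2 hK0.le), le_inv_mul_iff₀ hK0]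
    have := hFn (N k)
    change _ ≤ ‖T (F (N k))‖
    linarith

lemma lower (U : (ℕ →₀ ℝ) →ₗ[ℝ] X) (hU : ∀ f : ℕ →₀ ℝ, (∀ k, |f k| ≤ 1) → ‖U f‖ ≤ 1)
  (hU' : ∀ k, 99 / 100 ≤ ‖U (Finsupp.single k 1)‖)
  (x : ℕ →₀ ℝ) (i : ℕ) (hi : 0 ≤ x i) (hx : ∀ k, |x k| ≤ x i) :
    x i * (98 / 100) ≤ ‖U x‖ := by
  have h1 : ‖U (Finsupp.single i (2 * x i) - x)‖ ≤ x i * 1 := by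
    apply scale U 1 hU _ hi
    intro k
    rw [Finsupp.sub_apply, Finsupp.single_apply]
    split_ifs with h
    · subst h
      rw [show 2 * x i - x i = x i by ring]; exact hx i
    · rw [zero_sub, abs_neg]; exact hx k
  have h2 : U (Finsupp.single i (2 * x i)) = (2 * x i) • U (Finsupp.single i 1) := by
    rw [← map_smul]; simp
  have h3 : ‖U (Finsupp.single i (2 * x i))‖ = 2 * x i * ‖U (Finsupp.single i 1)‖ := by
    rw [h2, norm_smul, Real.norm_of_nonneg (by linarith)]
  have h4 : ‖U (Finsupp.single i (2 * x i))‖ ≤ ‖U (Finsupp.single i (2 * x i) - x)‖ + ‖U x‖ := by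
    rw [map_sub]
    simpa using norm_add_le (U (Finsupp.single i (2 * x i)) - U x) (U x)
  have h5 := mul_le_mul_of_nonneg_left (hU' i) (show 0 ≤ 2 * x i by linarith)
  linarith

lemma half (U : (ℕ →₀ ℝ) →ₗ[ℝ] X) (hU : ∀ f : ℕ →₀ ℝ, (∀ k, |f k| ≤ 1) → ‖U f‖ ≤ 1)
  (hU' : ∀ k, 99 / 100 ≤ ‖U (Finsupp.single k 1)‖)
  (x y : ℕ →₀ ℝ) (i : ℕ) (hi : 1 ≤ x i) (hx : ∀ k, k ≠ i → |x k| ≤ 3 / 4)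
    (η : ℝ) (hη : ∀ k, |y k - x k| ≤ η) :
    (y i - x i) - η / 5 ≤ ‖U y‖ - ‖U x‖ := by
  have hη0 : 0 ≤ η := (abs_nonneg _).trans (hη 0)
  have hlow : x i * (98 / 100) ≤ ‖U x‖ := by
    apply lower U hU hU' x i (by linarith)
    intro k
    by_cases hk : k = i
    · rw [hk, abs_of_nonneg (by linarith)]
    · have := hx k hk; linarith
  have hne : U x ≠ 0 := by
    intro h
    rw [h, norm_zero] at hlow
    linarith
  obtain ⟨g, hg1, hg2⟩ := exists_dual_vector ℝ (U x) (norm_ne_zero_iff.2 hne)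
  have hg2 : g (U x) = ‖U x‖ := by simpa using hg2
  have hgle : ∀ z, g z ≤ ‖z‖ := fun z => by
    have := g.le_opNorm z
    rw [hg1, one_mul] at this
    exact (le_abs_self _).trans this
  set G := g (U (Finsupp.single i 1)) with hG
  have hsing : ∀ c : ℝ, g (U (Finsupp.single i c)) = c * G := by
    intro c
    rw [hG, show Finsupp.single i c = c • Finsupp.single i (1:ℝ) by simp, map_smul, map_smul,
      smul_eq_mul]
  have hrest : ∀ (r : ℕ →₀ ℝ) (c : ℝ), 0 ≤ c → r i = 0 → (∀ k, |r k| ≤ c) →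
      g (U r) ≤ c * (1 - |G|) := by
    intro r c hc hri hr
    obtain ⟨s, hs, hsG⟩ : ∃ s : ℝ, |s| = 1 ∧ s * G = |G| := by
      rcases le_total 0 G with h | h
      · exact ⟨1, by simp, by rw [abs_of_nonneg h, one_mul]⟩
      · exact ⟨-1, by simp, by rw [abs_of_nonpos h]; ring⟩
    have h1 : ‖U (Finsupp.single i (c * s) + r)‖ ≤ c * 1 := by
      apply scale U 1 hU _ hc
      intro k
      rw [Finsupp.add_apply, Finsupp.single_apply]
      split_ifs with h
      · subst h
        rw [hri, add_zero, abs_mul, hs, abs_of_nonneg hc, mul_one]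
      · rw [zero_add]; exact hr k
    have h2 := hgle (U (Finsupp.single i (c * s) + r))
    replace h2 := h2.trans h1
    rw [map_add, map_add, hsing, mul_assoc, hsG] at h2
    linarith
  have hdec : ∀ z : ℕ →₀ ℝ, g (U z) = z i * G + g (U (z.erase i)) := by
    intro z
    conv_lhs => rw [← Finsupp.single_add_erase i z, map_add, map_add, hsing]
  have hx1 := hrest (x.erase i) (3 / 4) (by norm_num) (by simp) (by
    intro k
    rw [Finsupp.erase_apply]
    split_ifs with h
    · norm_num
    · exact hx k h)
  have hx2 := hdec x
  rw [hg2] at hx2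
  have hG1 : |G| ≤ 1 := by
    have := hrest 0 1 zero_le_one (by simp) (by simp)
    simp at this
    linarith
  have hGpos : 0 ≤ G := by
    by_contra h
    push Not at h
    have : x i * G ≤ 0 := mul_nonpos_of_nonneg_of_nonpos (by linarith) h.le
    have := abs_nonneg G
    linarith
  rw [abs_of_nonneg hGpos] at *
  have hG9 : 1 - G ≤ 1 / 10 := by nlinarith
  have hd1 := hrest ((x - y).erase i) η hη0 (by simp) (by
    intro k
    rw [Finsupp.erase_apply]
    split_ifs with h
    · simpa using hη0
    · rw [Finsupp.sub_apply, abs_sub_comm]; exact hη k)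
  have hd2 := hdec (x - y)
  have hy := hgle (U y)
  rw [map_sub, map_sub, Finsupp.sub_apply, hg2] at hd2
  have hi2 := (abs_le.1 (hη i))
  nlinarith [mul_nonneg (sub_nonneg.2 hi2.2) (sub_nonneg.2 hG1),
    mul_nonneg hη0 (sub_nonneg.2 hG9)]

/-- coefficients -/
noncomputable def p (ε : ℕ × ℕ → ℝ) (j : ℕ) : ℕ →₀ ℝ :=
  Finsupp.onFinset (Finset.range (j + 1))
    (fun k => if k < j then 1 / 2 + ε (k, j) else if k = j then -1 / 2 else 0) (by
      intro k hk
      by_contra h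
      simp only [Finset.mem_range, not_lt] at h
      exact hk (by rw [if_neg (by omega), if_neg (by omega)]))

lemma p_apply (ε : ℕ × ℕ → ℝ) (j k : ℕ) :
    p ε j k = if k < j then 1 / 2 + ε (k, j) else if k = j then -1 / 2 else 0 := rfl

lemma diff_i (ε : ℕ × ℕ → ℝ) {i j : ℕ} (h : i < j) : (p ε j - p ε i) i = 1 + ε (i, j) := by
  simp [p_apply, h]; ring

lemma diff_ne (ε : ℕ × ℕ → ℝ) (hε : ∀ q, ε q ∈ Set.Icc (0:ℝ) (1 / 4)) {i j : ℕ} (h : i < j)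
    (k : ℕ) (hk : k ≠ i) : |(p ε j - p ε i) k| ≤ 3 / 4 := by
  obtain ⟨h1, h2⟩ := hε (k, j)
  obtain ⟨h3, h4⟩ := hε (k, i)
  rw [Finsupp.sub_apply, p_apply, p_apply, abs_le]
  split_ifs <;> first | omega | (constructor <;> linarith)

lemma diff_diff (ε ε' : ℕ × ℕ → ℝ) (η : ℝ) (hη : ∀ q, |ε q - ε' q| ≤ η) (i j k : ℕ) :
    |(p ε j - p ε i) k - (p ε' j - p ε' i) k| ≤ 2 * η := by
  have h1 := abs_le.1 (hη (k, j))
  have h2 := abs_le.1 (hη (k, i))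
  simp only [Finsupp.sub_apply, p_apply]
  rw [abs_le]
  split_ifs <;> constructor <;> linarith

lemma fixed_pt (U : (ℕ →₀ ℝ) →ₗ[ℝ] X) (hU : ∀ f : ℕ →₀ ℝ, (∀ k, |f k| ≤ 1) → ‖U f‖ ≤ 1)
    (hU' : ∀ k, 99 / 100 ≤ ‖U (Finsupp.single k 1)‖) :
    ∃ ε : ℕ × ℕ → ℝ, ∀ i j, i < j → ‖U (p ε j) - U (p ε i)‖ = 1 := by
  let I := Set.Icc (0:ℝ) (1 / 4)
  let E := BoundedContinuousFunction (ℕ × ℕ) I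
  let z : I := ⟨0, by norm_num, by norm_num⟩
  let c : E → ℕ × ℕ → ℝ := fun ε q => (ε q : ℝ)
  have hc : ∀ ε q, c ε q ∈ I := fun ε q => (ε q).2
  let D : E → ℕ × ℕ → ℝ := fun ε q => ‖U (p (c ε) q.2 - p (c ε) q.1)‖
  have hφ : ∀ ε (q : ℕ × ℕ), q.1 < q.2 → 1 + c ε q - D ε q ∈ I := by
    rintro ε ⟨i, j⟩ h
    simp only at h
    obtain ⟨h1, h2⟩ := hc ε (i, j)
    have hi := diff_i (c ε) h
    have hall : ∀ k, |(p (c ε) j - p (c ε) i) k| ≤ (p (c ε) j - p (c ε) i) i := by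
      intro k
      by_cases hk : k = i
      · rw [hk, abs_of_nonneg]; rw [hi]; linarith
      · have := diff_ne (c ε) (hc ε) h k hk
        linarith
    have hl := lower U hU hU' _ i (by rw [hi]; linarith) hall
    have hu := scale U 1 hU _ (by rw [hi]; linarith) _ hall
    rw [hi] at hl hu
    change _ ≤ D ε (i, j) at hl
    change D ε (i, j) ≤ _ at hu
    constructor <;> linarith
  classical
  let Φ : E → E := fun ε => BoundedContinuousFunction.mkOfBound
    ⟨fun q => if h : q.1 < q.2 then ⟨1 + c ε q - D ε q, hφ ε q h⟩ else z,
      continuous_of_discreteTopology⟩ 1 (by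
        intro q q'
        refine le_trans (Real.dist_le_of_mem_Icc (Subtype.coe_prop _) (Subtype.coe_prop _)) ?_
        norm_num)
  have hΦ : ∀ ε q, q.1 < q.2 → (Φ ε q : ℝ) = 1 + c ε q - D ε q := by
    intro ε q h
    change ((if h : q.1 < q.2 then (⟨1 + c ε q - D ε q, hφ ε q h⟩ : I) else z : I) : ℝ) = _
    rw [dif_pos h]
  have hΦ0 : ∀ ε q, ¬ q.1 < q.2 → (Φ ε q) = z := by
    intro ε q h
    change ((if h : q.1 < q.2 then (⟨1 + c ε q - D ε q, hφ ε q h⟩ : I) else z : I)) = _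
    rw [dif_neg h]
  have hlip : ∀ ε ε' : E, dist (Φ ε) (Φ ε') ≤ 2 / 5 * dist ε ε' := by
    intro ε ε'
    rw [BoundedContinuousFunction.dist_le (by positivity)]
    rintro ⟨i, j⟩
    by_cases h : i < j
    · rw [Subtype.dist_eq, hΦ _ _ h, hΦ _ _ h, Real.dist_eq]
      have hη : ∀ q, |c ε q - c ε' q| ≤ dist ε ε' := fun q => ε.dist_coe_le_dist q
      have hη' : ∀ q, |c ε' q - c ε q| ≤ dist ε ε' := fun q => by
        rw [abs_sub_comm]; exact hη q
      have e1 := half U hU hU' (p (c ε) j - p (c ε) i) (p (c ε') j - p (c ε') i) i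
        (by rw [diff_i _ h]; linarith [(hc ε (i, j)).1]) (diff_ne _ (hc ε) h) _
        (diff_diff _ _ _ hη' i j)
      have e2 := half U hU hU' (p (c ε') j - p (c ε') i) (p (c ε) j - p (c ε) i) i
        (by rw [diff_i _ h]; linarith [(hc ε' (i, j)).1]) (diff_ne _ (hc ε') h) _
        (diff_diff _ _ _ hη i j)
      rw [diff_i _ h, diff_i _ h] at e1 e2
      change _ ≤ D ε' (i, j) - D ε (i, j) at e1
      change _ ≤ D ε (i, j) - D ε' (i, j) at e2
      rw [abs_le]
      constructor <;> linarith
    · rw [hΦ0 _ _ h, hΦ0 _ _ h, dist_self]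
      positivity
  have hcon : ContractingWith (2 / 5 : NNReal) Φ := by
    refine ⟨?_, LipschitzWith.of_dist_le_mul fun x y => ?_⟩
    · rw [← NNReal.coe_lt_coe]; norm_num
    · have := hlip x y
      simpa using this
  have : Nonempty E := ⟨BoundedContinuousFunction.const _ z⟩
  let ε := ContractingWith.fixedPoint Φ hcon
  have hfix : Φ ε = ε := hcon.fixedPoint_isFixedPt
  refine ⟨c ε, fun i j h => ?_⟩
  have := hΦ ε (i, j) h
  rw [hfix] at this
  change c ε (i, j) = _ at this
  rw [← map_sub]
  change D ε (i, j) = 1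
  linarith

/-- finitely supported sequences inside c₀ -/
noncomputable def emb : (ℕ →₀ ℝ) →ₗ[ℝ] C₀(ℕ, ℝ) where
  toFun f := ⟨⟨f, continuous_of_discreteTopology⟩, by
    rw [Filter.cocompact_eq_cofinite]
    apply Filter.Tendsto.congr' (f₁ := fun _ => (0:ℝ)) _ tendsto_const_nhds
    have := f.finite_support.compl_mem_cofinite
    filter_upwards [this] with k hk
    simpa using (Function.notMem_support.1 hk).symm⟩
  map_add' f g := by ext k; simp
  map_smul' c f := by ext k; simp

lemma emb_apply (f : ℕ →₀ ℝ) (k : ℕ) : emb f k = f k := rfl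

end EqC0

/-- Every real Banach space containing an isomorphic copy of `c₀` (a closed linear
subspace linearly homeomorphic to the space of real null sequences with the sup
norm) admits an infinite equilateral set. -/
theorem infinite_equilateral_of_contains_c0 {X : Type*} [NormedAddCommGroup X]
    [NormedSpace ℝ X] [CompleteSpace X]
    (hX : ∃ Y : Subspace ℝ X, IsClosed (Y : Set X) ∧
      Nonempty (C₀(ℕ, ℝ) ≃L[ℝ] Y)) :
    ∃ lam : ℝ, 0 < lam ∧ ∃ S : Set X, S.Infinite ∧
      ∀ x ∈ S, ∀ y ∈ S, x ≠ y → ‖x - y‖ = lam := by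
  obtain ⟨Y, -, ⟨e⟩⟩ := hX
  let T : (ℕ →₀ ℝ) →ₗ[ℝ] X := Y.subtype ∘ₗ (e : C₀(ℕ, ℝ) →L[ℝ] Y).toLinearMap ∘ₗ EqC0.emb
  have hTn : ∀ f, ‖T f‖ = ‖e (EqC0.emb f)‖ := fun f => rfl
  have hs : ∀ k, 1 ≤ ‖EqC0.emb (Finsupp.single k 1)‖ := by
    intro k
    rw [← ZeroAtInftyContinuousMap.norm_toBCF_eq_norm]
    have := (EqC0.emb (Finsupp.single k 1)).toBCF.norm_coe_le_norm k
    simpa [EqC0.emb_apply] using this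
  have hpos : 0 < ‖(e.symm : Y →L[ℝ] C₀(ℕ, ℝ))‖ + 1 := by positivity
  obtain ⟨U, hU, hU'⟩ := EqC0.james T ‖(e : C₀(ℕ, ℝ) →L[ℝ] Y)‖
    (‖(e.symm : Y →L[ℝ] C₀(ℕ, ℝ))‖ + 1)⁻¹ (inv_pos.2 hpos) (by
      intro f hf
      rw [hTn]
      have h1 := (e : C₀(ℕ, ℝ) →L[ℝ] Y).le_opNorm (EqC0.emb f)
      have h2 : ‖EqC0.emb f‖ ≤ 1 := by
        rw [← ZeroAtInftyContinuousMap.norm_toBCF_eq_norm,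
          BoundedContinuousFunction.norm_le zero_le_one]
        exact hf
      exact h1.trans (mul_le_of_le_one_right (norm_nonneg _) h2)) (by
      intro k
      rw [hTn, inv_le_iff_one_le_mul₀ hpos]
      have h1 := (e.symm : Y →L[ℝ] C₀(ℕ, ℝ)).le_opNorm (e (EqC0.emb (Finsupp.single k 1)))
      have h2 : (e.symm : Y →L[ℝ] C₀(ℕ, ℝ)) (e (EqC0.emb (Finsupp.single k 1)))
        = EqC0.emb (Finsupp.single k 1) := e.symm_apply_apply _
      rw [h2] at h1
      have h3 := hs k
      nlinarith [norm_nonneg (e (EqC0.emb (Finsupp.single k 1)))])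
  obtain ⟨ε, hε⟩ := EqC0.fixed_pt U hU hU'
  have hε' : ∀ i j, i ≠ j → ‖U (EqC0.p ε i) - U (EqC0.p ε j)‖ = 1 := by
    intro i j h
    rcases lt_or_gt_of_ne h with h | h
    · rw [norm_sub_rev]; exact hε _ _ h
    · exact hε _ _ h
  refine ⟨1, one_pos, Set.range fun j => U (EqC0.p ε j), ?_, ?_⟩
  · apply Set.infinite_range_of_injective
    intro i j h
    by_contra hne
    have := hε' i j hne
    simp only at h
    rw [h, sub_self, norm_zero] at this
    norm_num at this
  · rintro _ ⟨i, rfl⟩ _ ⟨j, rfl⟩ hne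
    exact hε' i j (fun h => hne (by rw [h]))
end

section
/- Let (M,d) be an infinite bounded separable metric space that is c-strongly concave for some c > 0. Then there is an infinite subset N ⊆ M such that (N,d) can be isometrically embedded into every real Banach space X containing an isomorphic copy of c₀ (i.e., having a closed linear subspace linearly homeomorphic to c₀). -/
open scoped ZeroAtInfty

universe u

/-- Almost equilateral infinite sequences. -/
lemma aux_seq (M : Type*) [MetricSpace M] [Infinite M]
    (k : ℝ) (hk : ∀ x y : M, dist x y ≤ k)
    (c : ℝ) (hc : 0 < c) (hd : ∀ x y : M, x ≠ y → c ≤ dist x y) :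
    ∃ a : ℝ, 0 < a ∧ ∃ x : ℕ → M, ∀ i j, i < j → x i ≠ x j ∧
      |dist (x i) (x j) - a| ≤ a / 32 := by
  classical
  let U : Ultrafilter M := Filter.hyperfilter M
  have hU : ∀ x : M, ∀ᶠ y in (U : Filter M), y ≠ x := by
    intro x
    have : ({x} : Set M)ᶜ ∈ Filter.hyperfilter M :=
      (Set.finite_singleton x).compl_mem_hyperfilter
    exact this
  have h1 : ∀ x : M, ∃ l ∈ Set.Icc c k, Filter.Tendsto (fun y => dist x y) U (nhds l) := by
    intro x
    have := (isCompact_Icc (a := c) (b := k)).ultrafilter_le_nhds (U.map (fun y => dist x y)) (by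
      rw [Filter.le_principal_iff]
      have : ∀ᶠ y in (U : Filter M), dist x y ∈ Set.Icc c k := by
        filter_upwards [hU x] with y hy
        exact ⟨hd x y hy.symm, hk x y⟩
      exact this)
    exact this
  choose l hl hlt using h1
  obtain ⟨a, ha, hat⟩ := (isCompact_Icc (a := c) (b := k)).ultrafilter_le_nhds (U.map l) (by
      rw [Filter.le_principal_iff]
      have : ∀ᶠ y in (U : Filter M), l y ∈ Set.Icc c k := by
        filter_upwards with y
        exact hl y
      exact this)
  have hat : Filter.Tendsto l U (nhds a) := hat
  have ha0 : 0 < a := lt_of_lt_of_le hc ha.1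
  have hP : ∀ᶠ x in (U : Filter M), |l x - a| < a / 64 := by
    have := Metric.tendsto_nhds.1 hat (a / 64) (by positivity)
    simpa [Real.dist_eq] using this
  have hR : ∀ x : M, |l x - a| < a / 64 →
      ∀ᶠ y in (U : Filter M), x ≠ y ∧ |dist x y - a| ≤ a / 32 := by
    intro x hx
    have := Metric.tendsto_nhds.1 (hlt x) (a / 64) (by positivity)
    filter_upwards [this, hU x] with y hy hyx
    refine ⟨hyx.symm, ?_⟩
    rw [Real.dist_eq] at hy
    rw [abs_lt] at hy hx
    rw [abs_le]
    constructor <;> linarith [hy.1, hy.2, hx.1, hx.2]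
  obtain ⟨f, -, hf⟩ := exists_seq_of_forall_finset_exists
    (fun x : M => |l x - a| < a / 64) (fun x y => x ≠ y ∧ |dist x y - a| ≤ a / 32) (by
      intro s hs
      have : ∀ᶠ y in (U : Filter M), ∀ x ∈ s, x ≠ y ∧ |dist x y - a| ≤ a / 32 := by
        rw [Filter.eventually_all_finset]
        intro x hx
        exact hR x (hs x hx)
      exact (hP.and this).exists)
  exact ⟨a, ha0, f, hf⟩

/-- James' distortion theorem for `c₀` (in the form needed). -/
lemma aux_james {X : Type*} [NormedAddCommGroup X] [NormedSpace ℝ X]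
    (g : (ℕ →₀ ℝ) →ₗ[ℝ] X) (C m : ℝ) (hm : 0 < m)
    (hC : ∀ a : ℕ →₀ ℝ, (∀ k, |a k| ≤ 1) → ‖g a‖ ≤ C)
    (hmm : ∀ (a : ℕ →₀ ℝ) k, m * |a k| ≤ ‖g a‖) (δ : ℝ) (hδ : 0 < δ) :
    ∃ U : (ℕ →₀ ℝ) →ₗ[ℝ] X,
      (∀ (a : ℕ →₀ ℝ) (r : ℝ), 0 < r → (∀ k, |a k| ≤ r) → ‖U a‖ ≤ (1 + δ) * r) ∧
      ∀ i, 1 - δ ≤ ‖U (Finsupp.single i 1)‖ := by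
  classical
  let S : ℕ → Set ℝ := fun n => {t | ∃ a : ℕ →₀ ℝ, (∀ k, |a k| ≤ 1) ∧ (∀ k < n, a k = 0) ∧ t = ‖g a‖}
  have hbdd : ∀ n, BddAbove (S n) := by
    intro n
    refine ⟨C, ?_⟩
    rintro t ⟨a, ha, -, rfl⟩
    exact hC a ha
  have hle : ∀ n (a : ℕ →₀ ℝ), (∀ k, |a k| ≤ 1) → (∀ k < n, a k = 0) → ‖g a‖ ≤ sSup (S n) := by
    intro n a h1 h2
    exact le_csSup (hbdd n) ⟨a, h1, h2, rfl⟩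
  have hne : ∀ n, (S n).Nonempty := fun n => ⟨‖g 0‖, 0, by simp, by simp, rfl⟩
  have hlow : ∀ n, m ≤ sSup (S n) := by
    intro n
    have h := hle n (Finsupp.single n 1) (by
      intro k
      rw [Finsupp.single_apply]; split_ifs <;> simp) (by
      intro k hk
      rw [Finsupp.single_apply, if_neg (by omega)])
    have h' := hmm (Finsupp.single n 1) n
    simp at h'
    linarith
  have hbb : BddBelow (Set.range fun n => sSup (S n)) := ⟨m, by rintro _ ⟨n, rfl⟩; exact hlow n⟩
  set K : ℝ := ⨅ n, sSup (S n) with hK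
  have hmK : m ≤ K := le_ciInf hlow
  have hK0 : 0 < K := lt_of_lt_of_le hm hmK
  have hKn : ∀ n, K ≤ sSup (S n) := fun n => ciInf_le hbb n
  obtain ⟨n0, hn0⟩ : ∃ n, sSup (S n) < K * (1 + δ) :=
    exists_lt_of_ciInf_lt (by nlinarith)
  obtain ⟨b, hb, hbd⟩ := exists_seq_of_forall_finset_exists
    (fun a : ℕ →₀ ℝ => (∀ k, |a k| ≤ 1) ∧ (∀ k < n0, a k = 0) ∧ K * (1 - δ) < ‖g a‖)
    (fun a b => ∀ k, a k ≠ 0 → b k = 0) (by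
      intro s hs
      let n := n0 + (s.sup fun a => a.support.sup id + 1)
      obtain ⟨_, ⟨a, ha1, ha2, rfl⟩, hlt⟩ := exists_lt_of_lt_csSup (hne n)
        (show K * (1 - δ) < sSup (S n) from lt_of_lt_of_le (by nlinarith) (hKn n))
      refine ⟨a, ⟨ha1, fun k hk => ha2 k (by omega), hlt⟩, ?_⟩
      intro x hx k hk
      apply ha2
      have e1 : k ≤ x.support.sup id := Finset.le_sup (f := id) (Finsupp.mem_support_iff.2 hk)
      have e2 : x.support.sup id + 1 ≤ s.sup fun a => a.support.sup id + 1 :=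
        Finset.le_sup (f := fun a : ℕ →₀ ℝ => a.support.sup id + 1) hx
      omega)
  have hdis : ∀ i j k, i ≠ j → b i k ≠ 0 → b j k = 0 := by
    intro i j k hij hi
    rcases lt_or_gt_of_ne hij with h | h
    · exact hbd i j h k hi
    · by_contra hj
      exact hi (hbd j i h k hj)
  refine ⟨K⁻¹ • (g ∘ₗ Finsupp.linearCombination ℝ b), ?_, ?_⟩
  · intro a r hr ha
    set v := Finsupp.linearCombination ℝ b a with hv
    have hvk : ∀ k, v k = ∑ i ∈ a.support, a i * b i k := by
      intro k
      rw [hv, Finsupp.linearCombination_apply, Finsupp.sum, Finsupp.finsetSum_apply]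
      rfl
    have hv1 : ∀ k, |v k| ≤ r := by
      intro k
      rw [hvk]
      by_cases h : ∃ i, b i k ≠ 0
      · obtain ⟨i, hi⟩ := h
        have : ∑ j ∈ a.support, a j * b j k = a i * b i k := by
          apply Finset.sum_eq_single i
          · intro j _ hj
            rw [hdis i j k hj.symm hi, mul_zero]
          · intro h
            rw [Finsupp.notMem_support_iff.1 h, zero_mul]
        rw [this, abs_mul]
        calc |a i| * |b i k| ≤ r * 1 :=
              mul_le_mul (ha i) ((hb i).1 k) (abs_nonneg _) hr.le
          _ = r := mul_one r
      · push Not at h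
        simp [h, hr.le]
    have hv2 : ∀ k < n0, v k = 0 := by
      intro k hk
      rw [hvk]
      exact Finset.sum_eq_zero fun i _ => by rw [(hb i).2.1 k hk, mul_zero]
    have h := hle n0 (r⁻¹ • v) (by
      intro k
      rw [Finsupp.smul_apply, smul_eq_mul, abs_mul, abs_inv, abs_of_pos hr, inv_mul_le_iff₀ hr, mul_one]
      exact hv1 k) (by
      intro k hk
      rw [Finsupp.smul_apply, hv2 k hk, smul_zero])
    rw [map_smul, norm_smul, norm_inv, Real.norm_of_nonneg hr.le, inv_mul_le_iff₀ hr] at h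
    change ‖K⁻¹ • g v‖ ≤ _
    rw [norm_smul, norm_inv, Real.norm_of_nonneg hK0.le, inv_mul_le_iff₀ hK0]
    nlinarith
  · intro i
    change _ ≤ ‖K⁻¹ • g (Finsupp.linearCombination ℝ b (Finsupp.single i 1))‖
    rw [Finsupp.linearCombination_single, one_smul, norm_smul, norm_inv,
      Real.norm_of_nonneg hK0.le, le_inv_mul_iff₀ hK0]
    exact (hb i).2.2.le

lemma aux_lower {X : Type*} [NormedAddCommGroup X] [NormedSpace ℝ X]
    (U : (ℕ →₀ ℝ) →ₗ[ℝ] X) (δ : ℝ)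
    (hU : ∀ (a : ℕ →₀ ℝ) (r : ℝ), 0 < r → (∀ k, |a k| ≤ r) → ‖U a‖ ≤ (1 + δ) * r)
    (h1 : ∀ i, 1 - δ ≤ ‖U (Finsupp.single i 1)‖)
    (v : ℕ →₀ ℝ) (i : ℕ) (hi : 0 < v i) (hv : ∀ k, |v k| ≤ v i) :
    (1 - 3 * δ) * v i ≤ ‖U v‖ := by
  have e1 := hU ((2 * v i) • Finsupp.single i 1 - v) (v i) hi (by
    intro k
    rw [Finsupp.sub_apply, Finsupp.smul_apply, Finsupp.single_apply]
    split_ifs with h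
    · subst h
      rw [smul_eq_mul, mul_one, abs_le]; constructor <;> linarith
    · simpa using hv k)
  have e2 : ‖U ((2 * v i) • Finsupp.single i 1)‖ = (2 * v i) * ‖U (Finsupp.single i 1)‖ := by
    rw [map_smul, norm_smul, Real.norm_of_nonneg (by linarith)]
  rw [map_sub] at e1
  have e3 := norm_sub_norm_le (U ((2 * v i) • Finsupp.single i 1)) (U v)
  have := h1 i
  nlinarith

lemma aux_est {X : Type*} [NormedAddCommGroup X] [NormedSpace ℝ X]
    (U : (ℕ →₀ ℝ) →ₗ[ℝ] X) (δ : ℝ) (hδ : 0 < δ)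
    (hU : ∀ (a : ℕ →₀ ℝ) (r : ℝ), 0 < r → (∀ k, |a k| ≤ r) → ‖U a‖ ≤ (1 + δ) * r)
    (h1 : ∀ i, 1 - δ ≤ ‖U (Finsupp.single i 1)‖)
    (v v' : ℕ →₀ ℝ) (i : ℕ) (hi : 5 / 4 ≤ v i) (hi2 : v i ≤ 2)
    (hv : ∀ k, k ≠ i → |v k| ≤ 1) (D : ℝ) (hD : ∀ k, |v k - v' k| ≤ D) :
    ‖U v‖ - ‖U v'‖ - (v i - v' i) ≤ 70 * δ * D := by
  rcases (le_trans (abs_nonneg _) (hD 0)).eq_or_lt with hD0 | hD0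
  · have : v = v' := by
      ext k
      have := hD k
      rw [← hD0, abs_nonpos_iff] at this
      linarith
    subst this
    simp [← hD0]
  have hall : ∀ k, |v k| ≤ v i := by
    intro k
    by_cases h : k = i
    · subst h; rw [abs_of_nonneg (by linarith)]
    · linarith [hv k h]
  have hlow := aux_lower U δ hU h1 v i (by linarith) hall
  obtain ⟨φ, hφ1, hφ2⟩ := exists_dual_vector'' ℝ (U v)
  have hφle : ∀ y, φ y ≤ ‖y‖ := fun y =>
    (le_abs_self _).trans ((φ.le_opNorm y).trans (by
      have := norm_nonneg y
      nlinarith))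
  have hφv : φ (U v) = ‖U v‖ := by simpa using hφ2
  have key : ∀ (z : ℕ →₀ ℝ) (B : ℝ), 0 < B → z i = 0 → (∀ k, |z k| ≤ B) →
      φ (U z) ≤ 32 * δ * B := by
    intro z B hB hzi hz
    have e1 := hU (v + (1 / (4 * B)) • z) (v i) (by linarith) (by
      intro k
      rw [Finsupp.add_apply, Finsupp.smul_apply, smul_eq_mul]
      by_cases h : k = i
      · subst h; rw [hzi, mul_zero, add_zero]; exact hall k
      · have e : |1 / (4 * B) * z k| ≤ 1 / 4 := by
          rw [abs_mul, abs_of_pos (by positivity), div_mul_eq_mul_div, one_mul,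
            div_le_iff₀ (by positivity)]
          linarith [hz k]
        linarith [abs_add_le (v k) (1 / (4 * B) * z k), hv k h])
    have e2 := hφle (U (v + (1 / (4 * B)) • z))
    rw [map_add, map_smul, map_add, map_smul, hφv, smul_eq_mul] at e2
    rw [map_add, map_smul] at e1
    have e3 : 1 / (4 * B) * φ (U z) ≤ 8 * δ := by nlinarith
    rw [div_mul_eq_mul_div, one_mul, div_le_iff₀ (by positivity)] at e3
    linarith
  have hui : φ (U (Finsupp.single i 1)) ≤ 1 + δ := by
    refine (hφle _).trans ?_
    have := hU (Finsupp.single i 1) 1 one_pos (by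
      intro k
      rw [Finsupp.single_apply]; split_ifs <;> simp)
    linarith
  have hw := key (v - (v i) • Finsupp.single i 1) 1 one_pos (by simp) (by
    intro k
    by_cases h : k = i
    · subst h; simp
    · simpa [Finsupp.single_apply, Ne.symm h] using hv k h)
  have hww := key ((v - v') - (v i - v' i) • Finsupp.single i 1) D hD0 (by simp) (by
    intro k
    by_cases h : k = i
    · subst h; simpa using hD0.le
    · simpa [Finsupp.single_apply, Ne.symm h] using hD k)
  rw [map_sub, map_smul, map_sub, map_smul, smul_eq_mul, hφv] at hw
  rw [map_sub, map_smul, map_sub, map_smul, smul_eq_mul, map_sub, map_sub, hφv] at hww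
  have hv' := hφle (U v')
  have hlo : 1 - 28.6 * δ ≤ φ (U (Finsupp.single i 1)) := by
    by_contra hcon
    push Not at hcon
    nlinarith
  set p := φ (U (Finsupp.single i 1))
  have hDi := abs_le.1 (hD i)
  have : (v i - v' i) * (p - 1) ≤ D * (28.6 * δ) := by
    refine (le_abs_self _).trans ?_
    rw [abs_mul]
    refine mul_le_mul (hD i) ?_ (abs_nonneg _) hD0.le
    rw [abs_le]; constructor <;> linarith
  nlinarith [mul_pos hδ hD0]

noncomputable def auxPt (t : ℕ × ℕ → ℝ) (i : ℕ) : ℕ →₀ ℝ :=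
  Finsupp.onFinset (Finset.range (i + 1))
    (fun k => if k = i then 1 else if k < i then -(1 / 2 + t (i, k)) else 0) (by
      intro k hk
      rw [Finset.mem_range]
      by_contra h
      apply hk
      rw [if_neg (by omega), if_neg (by omega)])

lemma auxPt_apply (t : ℕ × ℕ → ℝ) (i k : ℕ) :
    auxPt t i k = if k = i then 1 else if k < i then -(1 / 2 + t (i, k)) else 0 := rfl

lemma aux_main {X : Type*} [NormedAddCommGroup X] [NormedSpace ℝ X]
    (U : (ℕ →₀ ℝ) →ₗ[ℝ] X) (δ : ℝ) (hδ : 0 < δ) (hδ' : δ ≤ 1 / 1000)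
    (hU : ∀ (a : ℕ →₀ ℝ) (r : ℝ), 0 < r → (∀ k, |a k| ≤ r) → ‖U a‖ ≤ (1 + δ) * r)
    (h1 : ∀ i, 1 - δ ≤ ‖U (Finsupp.single i 1)‖)
    (E : ℕ → ℕ → ℝ) (hE : ∀ i j, i < j → |E i j - 3 / 2| ≤ 1 / 16) :
    ∃ x : ℕ → X, ∀ i j, i < j → ‖x i - x j‖ = E i j := by
  classical
  let V : (ℕ × ℕ → ℝ) → ℕ → ℕ → (ℕ →₀ ℝ) := fun t i j => auxPt t i - auxPt t j
  -- facts about V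
  have hVi : ∀ t i j, i < j → V t i j i = 3 / 2 + t (j, i) := by
    intro t i j hij
    simp only [V, Finsupp.sub_apply, auxPt_apply]
    rw [if_pos trivial, if_neg (by omega), if_pos hij]
    ring
  have hVk : ∀ t : ℕ × ℕ → ℝ, (∀ p, |t p| ≤ 1 / 8) → ∀ i j, i < j → ∀ k, k ≠ i →
      |V t i j k| ≤ 1 := by
    intro t ht i j hij k hk
    have a1 := abs_le.1 (ht (i, k))
    have a2 := abs_le.1 (ht (j, k))
    simp only [V, Finsupp.sub_apply, auxPt_apply]
    rw [abs_le]
    split_ifs <;> first | omega | (constructor <;> linarith [a1.1, a1.2, a2.1, a2.2])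
  have hVd : ∀ (t t' : ℕ × ℕ → ℝ) (D : ℝ), (∀ p, |t p - t' p| ≤ D) → ∀ i j, i < j → ∀ k,
      |V t i j k - V t' i j k| ≤ 2 * D := by
    intro t t' D hD i j hij k
    have a1 := abs_le.1 (hD (i, k))
    have a2 := abs_le.1 (hD (j, k))
    simp only [V, Finsupp.sub_apply, auxPt_apply]
    rw [abs_le]
    split_ifs <;> constructor <;> linarith [a1.1, a1.2, a2.1, a2.2]
  have hdiff : ∀ (t t' : ℕ × ℕ → ℝ) (D : ℝ), (∀ p, |t p| ≤ 1 / 8) → (∀ p, |t' p| ≤ 1 / 8) →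
      (∀ p, |t p - t' p| ≤ D) → ∀ i j, i < j →
      ‖U (V t i j)‖ - ‖U (V t' i j)‖ - (t (j, i) - t' (j, i)) ≤ 1 / 2 * D := by
    intro t t' D ht ht' hD i j hij
    have a1 := abs_le.1 (ht (j, i))
    have hD0 : 0 ≤ D := le_trans (abs_nonneg _) (hD 0)
    have := aux_est U δ hδ hU h1 (V t i j) (V t' i j) i (by rw [hVi t i j hij]; linarith)
      (by rw [hVi t i j hij]; linarith) (hVk t ht i j hij) (2 * D) (hVd t t' D hD i j hij)
    rw [hVi t i j hij, hVi t' i j hij] at this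
    nlinarith
  have hself : ∀ (t : ℕ × ℕ → ℝ), (∀ p, |t p| ≤ 1 / 8) → ∀ i j, i < j →
      |t (j, i) - ‖U (V t i j)‖ + E i j| ≤ 1 / 8 := by
    intro t ht i j hij
    have a1 := abs_le.1 (ht (j, i))
    have a2 := abs_le.1 (hE i j hij)
    have hvi := hVi t i j hij
    have hall : ∀ k, |V t i j k| ≤ V t i j i := by
      intro k
      by_cases h : k = i
      · subst h; rw [hvi, abs_of_nonneg (by linarith)]
      · rw [hvi]; linarith [hVk t ht i j hij k h]
    have b1 := aux_lower U δ hU h1 (V t i j) i (by rw [hvi]; linarith) hall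
    have b2 := hU (V t i j) _ (by rw [hvi]; linarith) hall
    rw [hvi] at b1 b2
    rw [abs_le]
    constructor <;> nlinarith
  -- the map
  let G0 : (ℕ × ℕ → ℝ) → ℕ × ℕ → ℝ := fun t p =>
    if p.2 < p.1 then max (-(1 / 8)) (min (1 / 8) (t p - ‖U (V t p.2 p.1)‖ + E p.2 p.1)) else 0
  have hG0 : ∀ t p, |G0 t p| ≤ 1 / 8 := by
    intro t p
    simp only [G0]
    split_ifs
    · rw [abs_le]
      exact ⟨le_max_left _ _, max_le (by norm_num) (min_le_left _ _)⟩
    · norm_num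
  have hG0' : ∀ t : ℕ × ℕ → ℝ, (∀ p, |t p| ≤ 1 / 8) → ∀ p : ℕ × ℕ, p.2 < p.1 →
      G0 t p = t p - ‖U (V t p.2 p.1)‖ + E p.2 p.1 := by
    intro t ht p hp
    have := abs_le.1 (hself t ht p.2 p.1 hp)
    simp only [G0]
    rw [if_pos hp, min_eq_right this.2, max_eq_right this.1]
  let G : BoundedContinuousFunction (ℕ × ℕ) ℝ → BoundedContinuousFunction (ℕ × ℕ) ℝ := fun t =>
    BoundedContinuousFunction.ofNormedAddCommGroup (G0 t) continuous_of_discreteTopology (1 / 8)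
      (fun p => hG0 t p)
  have hGa : ∀ t p, G t p = G0 t p := fun _ _ => rfl
  let s : Set (BoundedContinuousFunction (ℕ × ℕ) ℝ) := Metric.closedBall 0 (1 / 8)
  have hs : ∀ t, t ∈ s ↔ ∀ p, |t p| ≤ 1 / 8 := by
    intro t
    rw [mem_closedBall_zero_iff, BoundedContinuousFunction.norm_le (by norm_num)]
    rfl
  have hmaps : Set.MapsTo G s s := fun t _ => (hs _).2 (hG0 t)
  have hcon : ContractingWith (1 / 2) (hmaps.restrict G s s) := by
    refine ⟨by rw [← NNReal.coe_lt_coe]; norm_num, LipschitzWith.of_dist_le_mul ?_⟩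
    rintro ⟨t, ht⟩ ⟨t', ht'⟩
    change dist (G t) (G t') ≤ _ * dist t t'
    have hD : ∀ p, |t p - t' p| ≤ dist t t' := fun p =>
      BoundedContinuousFunction.dist_coe_le_dist (f := t) (g := t') p
    have hD' : ∀ p, |t' p - t p| ≤ dist t t' := fun p => by rw [abs_sub_comm]; exact hD p
    have hcast : (((1 / 2 : NNReal) : ℝ)) = 1 / 2 := by norm_num
    rw [hcast, BoundedContinuousFunction.dist_le (by positivity)]
    intro p
    rw [Real.dist_eq, hGa, hGa]
    by_cases hp : p.2 < p.1
    · have c1 := hdiff t t' _ ((hs t).1 ht) ((hs t').1 ht') hD p.2 p.1 hp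
      have c2 := hdiff t' t _ ((hs t').1 ht') ((hs t).1 ht) hD' p.2 p.1 hp
      rw [hG0' t ((hs t).1 ht) p hp, hG0' t' ((hs t').1 ht') p hp, abs_le]
      simp only [Prod.mk.eta] at c1 c2
      constructor <;> linarith
    · simp only [G0, if_neg hp, sub_zero, abs_zero]
      positivity
  obtain ⟨t, hts, hfix, -⟩ := ContractingWith.exists_fixedPoint' (s := s)
    Metric.isClosed_closedBall.isComplete hmaps hcon (x := 0)
    (Metric.mem_closedBall_self (by norm_num)) (edist_ne_top _ _)
  refine ⟨fun i => U (auxPt t i), ?_⟩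
  intro i j hij
  have e1 : G t (j, i) = t (j, i) := by rw [hfix]
  rw [hGa, hG0' t ((hs t).1 hts) (j, i) hij] at e1
  rw [← map_sub]
  change ‖U (V t i j)‖ = _
  simp only at e1
  linarith

lemma aux_c0 {X : Type*} [NormedAddCommGroup X] [NormedSpace ℝ X]
    (Y : Subspace ℝ X) (L : C₀(ℕ, ℝ) ≃L[ℝ] Y) :
    ∃ (g : (ℕ →₀ ℝ) →ₗ[ℝ] X) (C m : ℝ), 0 < m ∧
    (∀ a : ℕ →₀ ℝ, (∀ k, |a k| ≤ 1) → ‖g a‖ ≤ C) ∧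
    (∀ (a : ℕ →₀ ℝ) k, m * |a k| ≤ ‖g a‖) := by
  let ι : (ℕ →₀ ℝ) →ₗ[ℝ] C₀(ℕ, ℝ) :=
    { toFun := fun a => ⟨⟨a, continuous_of_discreteTopology⟩, by
        change Filter.Tendsto (fun k => a k) _ _
        rw [Filter.cocompact_eq_cofinite]
        apply tendsto_const_nhds.congr'
        have : {k | a k = 0} ∈ Filter.cofinite := by
          rw [Filter.mem_cofinite]
          exact a.hasFiniteSupport
        filter_upwards [this] with k hk
        exact hk.symm⟩
      map_add' := fun a b => by ext k; rfl
      map_smul' := fun r a => by ext k; rfl }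
  have hι : ∀ a k, ι a k = a k := fun _ _ => rfl
  let A : C₀(ℕ, ℝ) →L[ℝ] Y := L
  let B : Y →L[ℝ] C₀(ℕ, ℝ) := L.symm
  refine ⟨Y.subtype ∘ₗ (A : C₀(ℕ, ℝ) →ₗ[ℝ] Y) ∘ₗ ι, ‖A‖, (‖B‖ + 1)⁻¹, by positivity, ?_, ?_⟩
  · intro a ha
    change ‖A (ι a)‖ ≤ _
    refine A.le_opNorm_of_le ?_ |>.trans (mul_one _).le
    rw [← ZeroAtInftyContinuousMap.norm_toBCF_eq_norm,
      BoundedContinuousFunction.norm_le zero_le_one]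
    exact ha
  · intro a k
    change _ ≤ ‖A (ι a)‖
    rw [inv_mul_le_iff₀ (by positivity)]
    have e1 : |a k| ≤ ‖ι a‖ := by
      rw [← ZeroAtInftyContinuousMap.norm_toBCF_eq_norm]
      exact (ι a).toBCF.norm_coe_le_norm k
    have e2 : ‖ι a‖ ≤ ‖B‖ * ‖A (ι a)‖ := by
      have : B (A (ι a)) = ι a := L.symm_apply_apply _
      conv_lhs => rw [← this]
      exact B.le_opNorm _
    have := norm_nonneg (A (ι a))
    nlinarith

/-- If `(M, d)` is an infinite bounded separable strongly concave metric space, then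
there is an infinite subset `N ⊆ M` such that `(N, d)` embeds isometrically into
every real Banach space containing an isomorphic copy of `c₀`. -/
theorem exists_infinite_subset_embeds_of_contains_c0 (M : Type*) [MetricSpace M]
    [Infinite M] [TopologicalSpace.SeparableSpace M]
    (hbdd : ∃ k : ℝ, 0 < k ∧ ∀ x y : M, dist x y ≤ k)
    (hconc : ∃ c : ℝ, 0 < c ∧ ∀ x y z : M, x ≠ y → y ≠ z → x ≠ z →
      c ≤ dist x y + dist y z - dist x z) :
    ∃ N : Set M, N.Infinite ∧
      ∀ (X : Type u) [NormedAddCommGroup X] [NormedSpace ℝ X] [CompleteSpace X],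
        (∃ Y : Subspace ℝ X, IsClosed (Y : Set X) ∧
          Nonempty (C₀(ℕ, ℝ) ≃L[ℝ] Y)) →
        ∃ f : N → X, ∀ x y : N, ‖f x - f y‖ = dist (x : M) (y : M) := by
  classical
  obtain ⟨k, -, hk⟩ := hbdd
  obtain ⟨c, hc, hconc⟩ := hconc
  have hd : ∀ x y : M, x ≠ y → c ≤ dist x y := by
    intro x y hxy
    obtain ⟨z, hz⟩ := Infinite.exists_notMem_finset ({x, y} : Finset M)
    simp only [Finset.mem_insert, Finset.mem_singleton, not_or] at hz
    have e1 := hconc x y z hxy (Ne.symm hz.2) (Ne.symm hz.1)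
    have e2 := hconc y x z hxy.symm (Ne.symm hz.1) (Ne.symm hz.2)
    rw [dist_comm y x] at e2
    linarith
  obtain ⟨a, ha, x, hx⟩ := aux_seq M k hk c hc hd
  have hinj : Function.Injective x := by
    intro i j hij
    by_contra hne
    rcases lt_or_gt_of_ne hne with h | h
    · exact (hx i j h).1 hij
    · exact (hx j i h).1 hij.symm
  refine ⟨Set.range x, Set.infinite_range_of_injective hinj, ?_⟩
  rintro X _ _ _ ⟨Y, -, ⟨L⟩⟩
  obtain ⟨g, C, m, hm, hC, hmm⟩ := aux_c0 Y L
  obtain ⟨U, hU, h1⟩ := aux_james g C m hm hC hmm (1 / 1000) (by norm_num)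
  obtain ⟨y, hy⟩ := aux_main U (1 / 1000) (by norm_num) le_rfl hU h1
    (fun i j => 3 / (2 * a) * dist (x i) (x j)) (by
      intro i j hij
      have := abs_le.1 (hx i j hij).2
      have e : 3 / (2 * a) * dist (x i) (x j) - 3 / 2
          = 3 / (2 * a) * (dist (x i) (x j) - a) := by
        field_simp
      have e' : 3 / (2 * a) * (a / 32) = 3 / 64 := by field_simp; norm_num
      rw [e, abs_mul, abs_of_pos (by positivity)]
      have := mul_le_mul_of_nonneg_left (hx i j hij).2 (show 0 ≤ 3 / (2 * a) by positivity)
      linarith)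
  have hlt : ∀ i j, i < j →
      ‖(2 * a / 3) • y i - (2 * a / 3) • y j‖ = dist (x i) (x j) := by
    intro i j hij
    rw [← smul_sub, norm_smul, hy i j hij, Real.norm_of_nonneg (by positivity)]
    field_simp
  have hallij : ∀ i j, ‖(2 * a / 3) • y i - (2 * a / 3) • y j‖ = dist (x i) (x j) := by
    intro i j
    rcases lt_trichotomy i j with h | h | h
    · exact hlt i j h
    · subst h; simp
    · rw [norm_sub_rev, dist_comm]; exact hlt j i h
  refine ⟨fun p => (2 * a / 3) • y p.2.choose, fun p q => ?_⟩
  have := hallij p.2.choose q.2.choose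
  rw [p.2.choose_spec, q.2.choose_spec] at this
  exact this
end
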